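/- Let λ, μ ∈ X⁺ be dominant weights. There exists a bijection Φ : U(λ,μ) → V(λ,μ) such that for every (γ,w,n) ∈ U(λ,μ), writing Φ(γ,w,n) = (β,x,m), one has x = w⁻¹ and either (β = w⁻¹γ, m = −n and n < 0) or (β = −w⁻¹γ, m = n and n > ⟨λ+ρ,γ∨⟩). In particular every element (β,x,m) of V(λ,μ) corresponds to an element (γ,w,n) of U(λ,μ) with w = x⁻¹, γ = ±x⁻¹·... = ±(x applied inversely to β up to sign), |n| = m, and det(w) = det(x). -/

import Mathlib

open scoped InnerProductSpace Classical

noncomputable section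

variable {E : Type*} [NormedAddCommGroup E] [InnerProductSpace ℝ E]

/-- `⟨x, α∨⟩ = 2⟪x,α⟫/⟪α,α⟫`. -/
def coPair (x α : E) : ℝ := 2 * ⟪x, α⟫_ℝ / ⟪α, α⟫_ℝ

/-- The orthogonal reflection `s_α(x) = x − ⟨x,α∨⟩α`, as a plain function. -/
def sRefl (α x : E) : E := x - coPair x α • α

/-- `R` is a finite crystallographic root system in `E`. -/
structure IsRootSystem (R : Finset E) : Prop where
  span_eq_top : Submodule.span ℝ (R : Set E) = ⊤
  zero_not_mem : (0 : E) ∉ R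
  refl_stable : ∀ α ∈ R, ∀ β ∈ R, sRefl α β ∈ R
  crystallographic : ∀ α ∈ R, ∀ β ∈ R, ∃ n : ℤ, coPair β α = (n : ℝ)

/-- The positive roots with respect to a regular vector `v`. -/
def posR (R : Finset E) (v : E) : Finset E := R.filter fun α => 0 < ⟪v, α⟫_ℝ

/-- `ρ`, the half sum of the positive roots. -/
def rhoR (R : Finset E) (v : E) : E := (2 : ℝ)⁻¹ • ∑ α ∈ posR R v, α

/-- The Weyl group: the group of linear isometries of `E` generated by the
reflections `s_α`, `α ∈ R`. -/
def Weyl (R : Finset E) : Subgroup (E ≃ₗᵢ[ℝ] E) :=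
  Subgroup.closure {g | ∃ α ∈ R, ∀ x, g x = sRefl α x}

/-- The dot action `w·λ = w(λ+ρ) − ρ`. -/
def dotAct (R : Finset E) (v : E) (w : E ≃ₗᵢ[ℝ] E) (lam : E) : E :=
  w (lam + rhoR R v) - rhoR R v

/-- membership in the weight lattice `X`. -/
def IsWeight (R : Finset E) (lam : E) : Prop := ∀ α ∈ R, ∃ n : ℤ, coPair lam α = (n : ℝ)

/-- membership in `X⁺`, the set of dominant weights. -/
def IsDominant (R : Finset E) (v : E) (lam : E) : Prop :=
  IsWeight R lam ∧ ∀ α ∈ posR R v, 0 ≤ coPair lam α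

/-- the strict dominance order `λ < μ`:  `μ − λ` is a nonzero `ℕ`-linear
combination of positive roots. -/
def domLt (R : Finset E) (v : E) (lam mu : E) : Prop :=
  lam ≠ mu ∧ ∃ c : E → ℕ, mu - lam = ∑ α ∈ posR R v, (c α : ℝ) • α

/-- `V_β(λ,μ)`. -/
def VsetB (R : Finset E) (v lam mu β : E) : Set ((E ≃ₗᵢ[ℝ] E) × ℤ) :=
  {p | p.1 ∈ Weyl R ∧ 0 < p.2 ∧ (p.2 : ℝ) < coPair (mu + rhoR R v) β ∧
    dotAct R v p.1 lam = mu - (p.2 : ℝ) • β}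

/-- `U_γ(λ,μ)`. -/
def UsetG (R : Finset E) (v lam mu γ : E) : Set ((E ≃ₗᵢ[ℝ] E) × ℤ) :=
  {p | p.1 ∈ Weyl R ∧ (p.2 < 0 ∨ coPair (lam + rhoR R v) γ < (p.2 : ℝ)) ∧
    dotAct R v p.1 mu = lam - (p.2 : ℝ) • γ}

/-- `V(λ,μ)`. -/
def Vset (R : Finset E) (v lam mu : E) : Set (E × (E ≃ₗᵢ[ℝ] E) × ℤ) :=
  {t | t.1 ∈ posR R v ∧ (t.2.1, t.2.2) ∈ VsetB R v lam mu t.1}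

/-- `U(λ,μ)`. -/
def Uset (R : Finset E) (v lam mu : E) : Set (E × (E ≃ₗᵢ[ℝ] E) × ℤ) :=
  {t | t.1 ∈ posR R v ∧ (t.2.1, t.2.2) ∈ UsetG R v lam mu t.1}

theorem coPair_neg_right (x α : E) : coPair x (-α) = -coPair x α := by
  simp [coPair, neg_div]

theorem coPair_add_left (x y α : E) : coPair (x + y) α = coPair x α + coPair y α := by
  simp only [coPair, inner_add_left]; ring

theorem coPair_map_map (g : E ≃ₗᵢ[ℝ] E) (x α : E) : coPair (g x) (g α) = coPair x α := by
  simp [coPair]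

theorem coPair_self {α : E} (hα : α ≠ 0) : coPair α α = 2 := by
  have h : ⟪α, α⟫_ℝ ≠ 0 := inner_self_ne_zero.2 hα
  rw [coPair, mul_div_assoc, div_self h, mul_one]

theorem coPair_sub_smul_self {α : E} (hα : α ≠ 0) (x : E) (c : ℝ) :
    coPair (x - c • α) α = coPair x α - 2 * c := by
  have h : ⟪α, α⟫_ℝ ≠ 0 := inner_self_ne_zero.2 hα
  simp only [coPair, inner_sub_left, real_inner_smul_left]
  field_simp

theorem coPair_nonneg_iff {α : E} (hα : α ≠ 0) (x : E) : 0 ≤ coPair x α ↔ 0 ≤ ⟪x, α⟫_ℝ := by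
  have h : 0 < ⟪α, α⟫_ℝ := real_inner_self_pos.2 hα
  rw [coPair, le_div_iff₀ h]
  constructor <;> intro h <;> linarith

theorem coPair_sRefl {α : E} (hα : α ≠ 0) (x : E) : coPair (sRefl α x) α = -coPair x α := by
  rw [sRefl, coPair_sub_smul_self hα]; ring

theorem sRefl_sRefl {α : E} (hα : α ≠ 0) (x : E) : sRefl α (sRefl α x) = x := by
  rw [sRefl, coPair_sRefl hα, sRefl]; module

namespace IsRootSystem

variable {R : Finset E} {v : E}

theorem ne_zero (hR : IsRootSystem R) {α : E} (hα : α ∈ R) : α ≠ 0 :=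
  fun h => hR.zero_not_mem (h ▸ hα)

theorem neg_mem (hR : IsRootSystem R) {α : E} (hα : α ∈ R) : -α ∈ R := by
  have h := hR.refl_stable α hα α hα
  rw [sRefl, coPair_self (hR.ne_zero hα)] at h
  convert h using 1
  module

theorem map_mem_iff (hR : IsRootSystem R) {g : E ≃ₗᵢ[ℝ] E} (hg : g ∈ Weyl R) :
    ∀ α, g α ∈ R ↔ α ∈ R := by
  induction hg using Subgroup.closure_induction with
  | mem g hg =>
    obtain ⟨α, hα, h⟩ := hg
    intro β
    rw [h]
    refine ⟨fun hβ => ?_, hR.refl_stable α hα β⟩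
    simpa [sRefl_sRefl (hR.ne_zero hα)] using hR.refl_stable α hα _ hβ
  | one => simp
  | mul g k _ _ hg hk => intro β; exact (hg (k β)).trans (hk β)
  | inv g _ hg => intro β; rw [← hg]; simp [LinearIsometryEquiv.inv_def]

/-- Exactly one of `α`, `-α` is positive; this is the existence half. -/
theorem mem_posR_or_neg_mem_posR (hR : IsRootSystem R) (hv : ∀ α ∈ R, ⟪v, α⟫_ℝ ≠ 0)
    {α : E} (hα : α ∈ R) : α ∈ posR R v ∨ -α ∈ posR R v := by
  rcases (hv α hα).lt_or_gt with h | h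
  · exact .inr (Finset.mem_filter.2 ⟨hR.neg_mem hα, by simpa using h⟩)
  · exact .inl (Finset.mem_filter.2 ⟨hα, h⟩)

theorem coPair_rhoR_nonneg (hR : IsRootSystem R) {α : E} (hα : α ∈ posR R v) :
    0 ≤ coPair (rhoR R v) α := by
  obtain ⟨hαR, hαv⟩ := Finset.mem_filter.1 hα
  have hα0 := hR.ne_zero hαR
  rw [coPair_nonneg_iff hα0, rhoR, real_inner_smul_left, sum_inner]
  refine mul_nonneg (by norm_num) ?_
  have hinner : ∀ β, ⟪sRefl α β, α⟫_ℝ = -⟪β, α⟫_ℝ := fun β => by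
    have h : ⟪α, α⟫_ℝ ≠ 0 := inner_self_ne_zero.2 hα0
    rw [sRefl, coPair, inner_sub_left, real_inner_smul_left, div_mul_cancel₀ _ h]; ring
  rw [← Finset.sum_filter_add_sum_filter_not _ (fun β => 0 < ⟪v, sRefl α β⟫_ℝ)]
  refine add_nonneg (le_of_eq (Eq.symm ?_)) (Finset.sum_nonneg fun β hβ => ?_)
  · refine Finset.sum_involution (fun β _ => sRefl α β) (fun β _ => ?_) (fun β _ h0 h => ?_)
      (fun β hβ => ?_) (fun β _ => sRefl_sRefl hα0 β)
    · rw [hinner]; ring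
    · have := hinner β
      rw [h] at this
      exact h0 (by linarith)
    · simp only [posR, Finset.mem_filter, sRefl_sRefl hα0] at hβ ⊢
      exact ⟨⟨hR.refl_stable α hαR β hβ.1.1, hβ.2⟩, hβ.1.2⟩
  · simp only [posR, Finset.mem_filter, not_lt] at hβ
    obtain ⟨⟨-, hβv⟩, hle⟩ := hβ
    rw [← coPair_nonneg_iff hα0]
    rw [sRefl, inner_sub_right, real_inner_smul_right] at hle
    by_contra! hneg
    nlinarith

theorem coPair_add_rhoR_nonneg (hR : IsRootSystem R) {lam α : E} (hlam : IsDominant R v lam)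
    (hα : α ∈ posR R v) : 0 ≤ coPair (lam + rhoR R v) α := by
  rw [coPair_add_left]
  exact add_nonneg (hlam.2 α hα) (hR.coPair_rhoR_nonneg hα)

end IsRootSystem

theorem neg_not_mem_posR {R : Finset E} {v α : E} (hα : α ∈ posR R v) : -α ∉ posR R v := by
  intro h
  have h1 := (Finset.mem_filter.1 hα).2
  have h2 := (Finset.mem_filter.1 h).2
  rw [inner_neg_right] at h2
  linarith

theorem dotAct_eq_sub_smul_iff {R : Finset E} {v lam mu γ : E} {w : E ≃ₗᵢ[ℝ] E} {c : ℝ} :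
    dotAct R v w mu = lam - c • γ ↔ w (mu + rhoR R v) = lam + rhoR R v - c • γ := by
  rw [dotAct, sub_eq_iff_eq_add, sub_add_eq_add_sub]

theorem dotAct_inv_eq_sub_smul {R : Finset E} {v lam mu γ : E} {w : E ≃ₗᵢ[ℝ] E} {c : ℝ}
    (h : dotAct R v w mu = lam - c • γ) :
    dotAct R v w⁻¹ lam = mu - (-c) • w⁻¹ γ := by
  rw [dotAct_eq_sub_smul_iff] at h ⊢
  apply w.injective
  rw [map_sub, map_smul, h]
  simp only [LinearIsometryEquiv.inv_def, LinearIsometryEquiv.apply_symm_apply]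
  module

theorem coPair_inv_apply {R : Finset E} {v lam mu γ : E} {w : E ≃ₗᵢ[ℝ] E} {c : ℝ} (hγ : γ ≠ 0)
    (h : dotAct R v w mu = lam - c • γ) :
    coPair (mu + rhoR R v) (w⁻¹ γ) = coPair (lam + rhoR R v) γ - 2 * c := by
  rw [dotAct_eq_sub_smul_iff] at h
  rw [← coPair_sub_smul_self hγ, ← h, ← coPair_map_map w]
  simp [LinearIsometryEquiv.inv_def]

/-- A root on which a dominant weight, shifted by `ρ`, is strictly positive is a positive root. -/
theorem IsRootSystem.mem_posR_of_coPair_pos {R : Finset E} {v mu β : E} (hR : IsRootSystem R)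
    (hv : ∀ α ∈ R, ⟪v, α⟫_ℝ ≠ 0) (hmu : IsDominant R v mu) (hβ : β ∈ R)
    (h : 0 < coPair (mu + rhoR R v) β) : β ∈ posR R v := by
  refine (hR.mem_posR_or_neg_mem_posR hv hβ).resolve_right fun hneg => ?_
  have := hR.coPair_add_rhoR_nonneg hmu hneg
  rw [coPair_neg_right] at this
  linarith

/-- The correspondence `U(λ,μ) → V(λ,μ)` on underlying triples. -/
def flipTriple (t : E × (E ≃ₗᵢ[ℝ] E) × ℤ) : E × (E ≃ₗᵢ[ℝ] E) × ℤ :=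
  if t.2.2 < 0 then (t.2.1⁻¹ t.1, t.2.1⁻¹, -t.2.2) else (-(t.2.1⁻¹ t.1), t.2.1⁻¹, t.2.2)

section Correspondence

variable {R : Finset E} {v lam mu : E}

theorem flipTriple_mem_Vset (hR : IsRootSystem R) (hv : ∀ α ∈ R, ⟪v, α⟫_ℝ ≠ 0)
    (hlam : IsDominant R v lam) (hmu : IsDominant R v mu) {t : E × (E ≃ₗᵢ[ℝ] E) × ℤ}
    (ht : t ∈ Uset R v lam mu) : flipTriple t ∈ Vset R v lam mu := by
  obtain ⟨γ, w, n⟩ := t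
  obtain ⟨hγ, hw, hn, heq⟩ := ht
  dsimp only at hγ hw hn heq
  have hγR := (Finset.mem_filter.1 hγ).1
  have hβ : w⁻¹ γ ∈ R := (hR.map_mem_iff (inv_mem hw) γ).2 hγR
  have ha := hR.coPair_add_rhoR_nonneg hlam hγ
  have hc := coPair_inv_apply (hR.ne_zero hγR) heq
  have hinv := dotAct_inv_eq_sub_smul heq
  by_cases h : n < 0
  · have h' : (n : ℝ) < 0 := by exact_mod_cast h
    rw [flipTriple, if_pos h]
    exact ⟨hR.mem_posR_of_coPair_pos hv hmu hβ (by linarith), inv_mem hw, by simpa using h,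
      by push_cast; linarith, by push_cast; exact hinv⟩
  · have h' := hn.resolve_left h
    rw [flipTriple, if_neg h]
    refine ⟨hR.mem_posR_of_coPair_pos hv hmu (hR.neg_mem hβ) ?_, inv_mem hw, ?_, ?_, ?_⟩
    · rw [coPair_neg_right]; linarith
    · exact_mod_cast ha.trans_lt h'
    · dsimp only; rw [coPair_neg_right]; linarith
    · dsimp only; rw [hinv]; module

theorem flipTriple_injOn : Set.InjOn flipTriple (Uset R v lam mu) := by
  rintro ⟨γ, w, n⟩ ⟨hγ, -⟩ ⟨γ', w', n'⟩ ⟨hγ', -⟩ h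
  dsimp only at hγ hγ'
  have hw : w = w' := by
    have := congrArg (fun t => t.2.1) h
    simp only [flipTriple, apply_ite (fun t : E × (E ≃ₗᵢ[ℝ] E) × ℤ => t.2.1), ite_self] at this
    exact inv_injective this
  subst hw
  by_cases hn : n < 0 <;> by_cases hn' : n' < 0 <;>
    simp only [flipTriple, hn, hn', if_true, if_false, Prod.mk.injEq, true_and, neg_inj] at h
  · simp [(w⁻¹).injective h.1, h.2]
  · rw [← map_neg] at h
    exact absurd ((w⁻¹).injective h.1 ▸ hγ) (neg_not_mem_posR hγ')
  · rw [← map_neg] at h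
    exact absurd ((w⁻¹).injective h.1 ▸ hγ') (neg_not_mem_posR hγ)
  · simp [(w⁻¹).injective h.1, h.2]

theorem flipTriple_surjOn (hR : IsRootSystem R) (hv : ∀ α ∈ R, ⟪v, α⟫_ℝ ≠ 0) :
    Set.SurjOn flipTriple (Uset R v lam mu) (Vset R v lam mu) := by
  rintro ⟨β, x, m⟩ ⟨hβ, hx, hm, hlt, heq⟩
  dsimp only at hβ hx hm hlt heq
  have hβR := (Finset.mem_filter.1 hβ).1
  have hγ : x⁻¹ β ∈ R := (hR.map_mem_iff (inv_mem hx) β).2 hβR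
  have hc := coPair_inv_apply (hR.ne_zero hβR) heq
  have hinv := dotAct_inv_eq_sub_smul heq
  rcases hR.mem_posR_or_neg_mem_posR hv hγ with h | h
  · refine ⟨(x⁻¹ β, x⁻¹, -m), ⟨h, inv_mem hx, .inl (by simpa using hm), ?_⟩, ?_⟩
    · push_cast; exact hinv
    · simp [flipTriple, hm, LinearIsometryEquiv.inv_def]
  · refine ⟨(-(x⁻¹ β), x⁻¹, m), ⟨h, inv_mem hx, .inr ?_, ?_⟩, ?_⟩
    · dsimp only; rw [coPair_neg_right]; linarith
    · dsimp only; rw [hinv]; module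
    · simp [flipTriple, hm.not_gt, LinearIsometryEquiv.inv_def]

end Correspondence

theorem statement1 [FiniteDimensional ℝ E] (R : Finset E) (hR : IsRootSystem R)
    (v : E) (hv : ∀ α ∈ R, ⟪v, α⟫_ℝ ≠ 0)
    (lam mu : E) (hlam : IsDominant R v lam) (hmu : IsDominant R v mu) :
    ∃ Φ : Uset R v lam mu ≃ Vset R v lam mu,
      ∀ t : Uset R v lam mu,
        (Φ t).1.2.1 = ((t : E × (E ≃ₗᵢ[ℝ] E) × ℤ).2.1)⁻¹ ∧
        (((Φ t).1.1 = ((t : E × (E ≃ₗᵢ[ℝ] E) × ℤ).2.1)⁻¹ (t : E × (E ≃ₗᵢ[ℝ] E) × ℤ).1 ∧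
            (Φ t).1.2.2 = -(t : E × (E ≃ₗᵢ[ℝ] E) × ℤ).2.2 ∧
            (t : E × (E ≃ₗᵢ[ℝ] E) × ℤ).2.2 < 0) ∨
         ((Φ t).1.1 = -(((t : E × (E ≃ₗᵢ[ℝ] E) × ℤ).2.1)⁻¹ (t : E × (E ≃ₗᵢ[ℝ] E) × ℤ).1) ∧
            (Φ t).1.2.2 = (t : E × (E ≃ₗᵢ[ℝ] E) × ℤ).2.2 ∧
            coPair (lam + rhoR R v) (t : E × (E ≃ₗᵢ[ℝ] E) × ℤ).1 <
              ((t : E × (E ≃ₗᵢ[ℝ] E) × ℤ).2.2 : ℝ))) := by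
  have hbij : Set.BijOn flipTriple (Uset R v lam mu) (Vset R v lam mu) :=
    ⟨fun _ ht => flipTriple_mem_Vset hR hv hlam hmu ht, flipTriple_injOn, flipTriple_surjOn hR hv⟩
  refine ⟨hbij.equiv flipTriple, fun ⟨⟨γ, w, n⟩, ht⟩ => ?_⟩
  change (flipTriple (γ, w, n)).2.1 = w⁻¹ ∧
    ((flipTriple (γ, w, n)).1 = w⁻¹ γ ∧ (flipTriple (γ, w, n)).2.2 = -n ∧ n < 0 ∨
      (flipTriple (γ, w, n)).1 = -(w⁻¹ γ) ∧ (flipTriple (γ, w, n)).2.2 = n ∧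
        coPair (lam + rhoR R v) γ < (n : ℝ))
  by_cases h : n < 0
  · simp [flipTriple, h]
  · have hn : coPair (lam + rhoR R v) γ < (n : ℝ) := ht.2.2.1.resolve_left h
    simp [flipTriple, h, hn]

end
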